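/- arXiv:math/9402214 — 3 statements merged into one kernel-verified Lean document; each statement's English description precedes it below -/
import Mathlib

section
/- Let α be an ordinal and let p, q be finite sets of ordinals such that every element of p is greater than or equal to α and every element of q is strictly greater than α. If q ≤* p and p ≤* q ∪ {α}, then p = q or p = q ∪ {α}. -/
/-- The ordering `p ≤* q` on finite sets of ordinals: either `p = q`, or the maximum
element of the symmetric difference of `p` and `q` belongs to `q`.  This is the
lexicographic ordering of the decreasing enumerations. -/
def LeStar (p q : Finset Ordinal) : Prop :=
  p = q ∨ ∃ m ∈ symmDiff p q, (∀ x ∈ symmDiff p q, x ≤ m) ∧ m ∈ q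

/-- The combinatorial content of Lemma 4.2: if every element of `p` is `≥ α`, every
element of `q` is `> α`, `q ≤* p` and `p ≤* q ∪ {α}`, then `p = q` or `p = q ∪ {α}`. -/
theorem leStar_dichotomy (α : Ordinal) (p q : Finset Ordinal)
    (hp : ∀ x ∈ p, α ≤ x) (hq : ∀ x ∈ q, α < x)
    (h1 : LeStar q p) (h2 : LeStar p (insert α q)) :
    p = q ∨ p = insert α q := by
  rcases h1 with rfl | ⟨m, hm, hmax, hmp⟩
  · exact Or.inl rfl
  rcases h2 with h | ⟨n, hn, hnmax, hnq⟩
  · exact Or.inr h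
  exfalso
  have hmq : m ∉ q := by
    simp only [Finset.mem_symmDiff] at hm
    tauto
  have hnp : n ∉ p := by
    simp only [Finset.mem_symmDiff] at hn
    tauto
  have hne : m ≠ n := fun h => hnp (h ▸ hmp)
  rcases Finset.mem_insert.mp hnq with rfl | hnq'
  · exact hne ((hnmax m (by simp [Finset.mem_symmDiff, hmp, hmq, hne])).antisymm (hp m hmp))
  · have hnm : n ≤ m := hmax n (by simp [Finset.mem_symmDiff, hnq', hnp])
    have hmα : m ≠ α := ((hq n hnq').trans_le hnm).ne'
    exact hne ((hnmax m (by simp [Finset.mem_symmDiff, hmp, hmq, hmα])).antisymm hnm)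
end

section
/- Assume (D̃_κ) is a global square system on the singular cardinals. If κ is a singular cardinal that is a limit of limit cardinals and λ ∈ I(κ), then λ is a singular cardinal which is a limit of limit cardinals and λ ∈ I(λ). Moreover, for every singular cardinal λ, if λ ∈ I(λ) then λ has cofinality ω. -/
/-- An ordinal is a cardinal if it is an initial ordinal. -/
def IsCard (o : Ordinal) : Prop := o.card.ord = o

/-- An ordinal is a singular cardinal if it is an infinite cardinal whose
cofinality is smaller than itself. -/
def IsSingular (o : Ordinal) : Prop := IsCard o ∧ Ordinal.omega0 ≤ o ∧ o.cof.ord < o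

/-- `a` is a limit point (accumulation point) of the set of ordinals `D`. -/
def IsAcc (D : Set Ordinal) (a : Ordinal) : Prop :=
  0 < a ∧ ∀ b < a, ∃ c ∈ D, b < c ∧ c < a

/-- `D` is a club (closed unbounded) subset of `μ`. -/
def IsClubIn (D : Set Ordinal) (μ : Ordinal) : Prop :=
  D ⊆ Set.Iio μ ∧ (∀ a < μ, IsAcc D a → a ∈ D) ∧ (∀ b < μ, ∃ c ∈ D, b < c)

/-- The order type of a set of ordinals: the least ordinal `o` such that `D` is
order-isomorphic to `Set.Iio o`. -/
noncomputable def otype (D : Set Ordinal) : Ordinal :=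
  sInf {o : Ordinal | Nonempty (↥D ≃o ↥(Set.Iio o))}

/-- An ordinal is a limit cardinal: an uncountable cardinal which is a limit
of cardinals. -/
def IsLimitCard (o : Ordinal) : Prop :=
  IsCard o ∧ Ordinal.omega0 < o ∧ ∀ x < o, ∃ y, x < y ∧ y < o ∧ IsCard y

/-- An ordinal is a limit of limit cardinals. -/
def IsLimLimCard (o : Ordinal) : Prop :=
  ∀ x < o, ∃ y, x < y ∧ y < o ∧ IsLimitCard y

/-- `E_κ`: the set of singular cardinals belonging to `D̃_κ`. -/
def EOf (Dt : Ordinal → Set Ordinal) (κ : Ordinal) : Set Ordinal :=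
  {x ∈ Dt κ | IsSingular x}

/-- `(E_κ)′` is cofinal in `κ`. -/
def EAccCofinal (Dt : Ordinal → Set Ordinal) (κ : Ordinal) : Prop :=
  ∀ b < κ, ∃ a, b < a ∧ a < κ ∧ IsAcc (EOf Dt κ) a

open scoped Classical in
/-- `D*_κ`: the set of limit points of `E_κ` below `κ` if this set is cofinal in `κ`,
and `∅` otherwise. -/
noncomputable def DstarOf (Dt : Ordinal → Set Ordinal) (κ : Ordinal) : Set Ordinal :=
  if EAccCofinal Dt κ then {a | a < κ ∧ IsAcc (EOf Dt κ) a} else ∅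

open scoped Classical in
/-- `I(κ)`: the set of elements of `D*_κ` that are not limit points of `D*_κ`, if
`(E_κ)′` is cofinal in `κ`; and `{κ}` otherwise. -/
noncomputable def IOf (Dt : Ordinal → Set Ordinal) (κ : Ordinal) : Set Ordinal :=
  if EAccCofinal Dt κ then {a ∈ DstarOf Dt κ | ¬ IsAcc (DstarOf Dt κ) a} else {κ}

open scoped Cardinal in
theorem exists_isAcc_of_aleph0_lt_cof {S : Set Ordinal} {o : Ordinal} (hcof : ℵ₀ < o.cof)
    (hS : ∀ b < o, ∃ c ∈ S, b < c ∧ c < o) {b : Ordinal} (hb : b < o) :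
    ∃ a, b < a ∧ a < o ∧ IsAcc S a := by
  choose! next hmem hlt hnext using hS
  let f : ℕ → Ordinal := fun n => next^[n] b
  have hsucc (n : ℕ) : f (n + 1) = next (f n) := Function.iterate_succ_apply' next n b
  have hf (n : ℕ) : f n < o := by
    induction n with
    | zero => exact hb
    | succ n ih => rw [hsucc]; exact hnext _ ih
  have hstep (n : ℕ) : f n < f (n + 1) := by rw [hsucc]; exact hlt _ (hf n)
  have hlt_sup (n : ℕ) : f n < ⨆ i, f i := (hstep n).trans_le (Ordinal.le_iSup f (n + 1))
  have hbs : b < ⨆ i, f i := hlt_sup 0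
  have hsup : ⨆ i, f i < o := by
    apply Ordinal.lift_iSup_lt_of_lt_cof _ hf
    simpa using hcof
  refine ⟨⨆ i, f i, hbs, hsup, zero_le.trans_lt hbs, fun x hx => ?_⟩
  obtain ⟨n, hn⟩ := Ordinal.lt_iSup_iff.1 hx
  refine ⟨f (n + 1), ?_, hn.trans (hstep n), hlt_sup (n + 1)⟩
  rw [hsucc]
  exact hmem _ (hf n)

theorem IsAcc.mono {S T : Set Ordinal} {a : Ordinal} (h : IsAcc S a) (hST : S ⊆ T) :
    IsAcc T a :=
  ⟨h.1, fun b hb => let ⟨c, hc, hbc, hca⟩ := h.2 b hb; ⟨c, hST hc, hbc, hca⟩⟩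

theorem isAcc_inter_Iio_iff {S : Set Ordinal} {a o : Ordinal} (hao : a ≤ o) :
    IsAcc (S ∩ Set.Iio o) a ↔ IsAcc S a :=
  ⟨fun h => h.mono Set.inter_subset_left, fun h => ⟨h.1, fun b hb =>
    let ⟨c, hc, hbc, hca⟩ := h.2 b hb; ⟨c, ⟨hc, hca.trans_le hao⟩, hbc, hca⟩⟩⟩

open scoped Cardinal in
theorem IsSingular.isLimitCard {o : Ordinal} (h : IsSingular o) : IsLimitCard o := by
  obtain ⟨hcard, hω, hcof⟩ := h
  have hne : Ordinal.omega0 ≠ o := by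
    rintro rfl
    simp at hcof
  have hlt := hω.lt_of_ne hne
  refine ⟨hcard, hlt, fun x hx => ⟨(Order.succ x.card).ord, ?_, ?_, ?_⟩⟩
  · exact Cardinal.lt_ord.2 (Order.lt_succ _)
  · have hxc : x.card < o.card := by rwa [← hcard, Cardinal.lt_ord] at hx
    have hle : (Order.succ x.card).ord ≤ o := Cardinal.ord_le.2 (Order.succ_le_of_lt hxc)
    refine hle.lt_of_ne fun heq => ?_
    rcases le_or_gt ℵ₀ x.card with hx0 | hx0
    · rw [← heq, (Cardinal.isRegular_succ hx0).cof_ord] at hcof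
      exact hcof.false
    · have : Order.succ x.card ≤ ℵ₀ := Order.succ_le_of_lt hx0
      rw [← Cardinal.ord_le_ord, heq, Cardinal.ord_aleph0] at this
      exact hlt.not_ge this
  · simp [IsCard]

theorem EOf_eq_inter_of_eq_inter {Dt : Ordinal → Set Ordinal} {κ lam : Ordinal}
    (h : Dt lam = Dt κ ∩ Set.Iio lam) : EOf Dt lam = EOf Dt κ ∩ Set.Iio lam := by
  ext x
  simp only [EOf, h, Set.mem_ofPred_eq, Set.mem_inter_iff]
  tauto

theorem self_mem_IOf_iff {Dt : Ordinal → Set Ordinal} {lam : Ordinal} :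
    lam ∈ IOf Dt lam ↔ ¬ EAccCofinal Dt lam := by
  by_cases h : EAccCofinal Dt lam <;> simp [IOf, DstarOf, h]

open scoped Cardinal in
theorem eAccCofinal_of_aleph0_lt_cof {Dt : Ordinal → Set Ordinal} {lam : Ordinal}
    (hclub : IsClubIn (Dt lam) lam) (hsing : ∀ a < lam, IsAcc (Dt lam) a → IsSingular a)
    (hcof : ℵ₀ < lam.cof) : EAccCofinal Dt lam := by
  obtain ⟨hsub, hclosed, hunb⟩ := hclub
  refine fun b hb => exists_isAcc_of_aleph0_lt_cof hcof (fun x hx => ?_) hb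
  obtain ⟨a, hxa, hal, ha⟩ := exists_isAcc_of_aleph0_lt_cof hcof
    (fun y hy => let ⟨c, hc, hyc⟩ := hunb y hy; ⟨c, hc, hyc, hsub hc⟩) hx
  exact ⟨a, ⟨hclosed a hal ha, hsing a hal ha⟩, hxa, hal⟩

/-- The auxiliary claims of §9.1 about the sets `I(κ)`: for a global square system
`D̃` on the singular cardinals, every `λ ∈ I(κ)` (for `κ` a singular limit of limit
cardinals) is a singular limit of limit cardinals with `λ ∈ I(λ)`; and every singular
`λ` with `λ ∈ I(λ)` has cofinality `ω`. -/
theorem IOf_spec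
    (Dt : Ordinal → Set Ordinal)
    (hDt : ∀ κ, IsSingular κ →
      IsClubIn (Dt κ) κ ∧ otype (Dt κ) < sInf (Dt κ) ∧
      ∀ lam < κ, IsAcc (Dt κ) lam → IsSingular lam ∧ Dt lam = Dt κ ∩ Set.Iio lam) :
    (∀ κ, IsSingular κ → IsLimLimCard κ → ∀ lam ∈ IOf Dt κ,
      IsSingular lam ∧ IsLimLimCard lam ∧ lam ∈ IOf Dt lam) ∧
    (∀ lam, IsSingular lam → lam ∈ IOf Dt lam → lam.cof = Cardinal.aleph0) := by
  refine ⟨fun κ hκ hlim lam hlam => ?_, fun lam hsing hlam => ?_⟩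
  · by_cases hE : EAccCofinal Dt κ
    · obtain ⟨⟨hlt, hacc⟩, hnacc⟩ :
          (lam < κ ∧ IsAcc (EOf Dt κ) lam) ∧
            ¬ IsAcc {a | a < κ ∧ IsAcc (EOf Dt κ) a} lam := by
        simpa [IOf, DstarOf, hE] using hlam
      obtain ⟨hsing, heq⟩ := (hDt κ hκ).2.2 lam hlt (hacc.mono fun _ hx => hx.1)
      refine ⟨hsing, fun x hx => ?_, self_mem_IOf_iff.2 fun hcof => hnacc ⟨hacc.1, fun b hb => ?_⟩⟩
      · obtain ⟨c, hc, hxc, hcl⟩ := hacc.2 x hx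
        exact ⟨c, hxc, hcl, hc.2.isLimitCard⟩
      · obtain ⟨a, hba, hal, ha⟩ := hcof b hb
        rw [EOf_eq_inter_of_eq_inter heq, isAcc_inter_Iio_iff hal.le] at ha
        exact ⟨a, ⟨hal.trans hlt, ha⟩, hba, hal⟩
    · obtain rfl : lam = κ := by simpa [IOf, hE] using hlam
      exact ⟨hκ, hlim, hlam⟩
  · refine le_antisymm (not_lt.1 fun hcof => self_mem_IOf_iff.1 hlam ?_) ?_
    · exact eAccCofinal_of_aleph0_lt_cof (hDt lam hsing).1
        (fun a ha hacc => ((hDt lam hsing).2.2 a ha hacc).1) hcof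
    · rw [Ordinal.aleph0_le_cof_iff, Ordinal.one_lt_cof_iff, ← hsing.1]
      apply Cardinal.isSuccLimit_ord
      rw [← Cardinal.ord_le_ord, hsing.1, Cardinal.ord_aleph0]
      exact hsing.2.1
end

section
/- Let N be a set of ordinals, let κ be an infinite cardinal with κ ∉ N such that N contains an ordinal greater than κ, and let μ be the least element of N greater than κ. Suppose there is an Easton set d of ordinals with κ ∈ d such that sup(d ∩ ν) ∈ N for every ν ∈ N. Then μ is not an uncountable regular limit cardinal. -/
/-- An ordinal is an uncountable regular limit cardinal (weakly inaccessible). -/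
def IsWeakInacc (o : Ordinal) : Prop := IsLimitCard o ∧ o.cof.ord = o

/-- A set of ordinals is Easton if its intersection with any uncountable regular
limit cardinal `λ` is bounded below `λ`. -/
def IsEaston (d : Set Ordinal) : Prop :=
  ∀ lam, IsWeakInacc lam → ∃ b < lam, ∀ x ∈ d, x < lam → x ≤ b

/-- The combinatorial content of Remark (10.1.4): if `κ ∉ N` is an infinite cardinal
belonging to an Easton set `d` such that `N` is closed under `ν ↦ sup (d ∩ ν)`, then
the least element `μ` of `N` above `κ` is not weakly inaccessible. -/
theorem least_above_not_inaccessible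
    (N : Set Ordinal) (κ μ : Ordinal)
    (hcard : IsCard κ) (hinf : Ordinal.omega0 ≤ κ) (hκN : κ ∉ N)
    (hex : ∃ ν ∈ N, κ < ν)
    (hμN : μ ∈ N) (hκμ : κ < μ) (hleast : ∀ ν ∈ N, κ < ν → μ ≤ ν)
    (d : Set Ordinal) (hd : IsEaston d) (hκd : κ ∈ d)
    (hclosure : ∀ ν ∈ N, sSup (d ∩ Set.Iio ν) ∈ N) :
    ¬ IsWeakInacc μ := by
  intro hμ
  obtain ⟨b, hbμ, hb⟩ := hd μ hμ
  have hκ : κ ∈ d ∩ Set.Iio μ := ⟨hκd, hκμ⟩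
  have hub : ∀ x ∈ d ∩ Set.Iio μ, x ≤ b := fun x hx => hb x hx.1 hx.2
  have hle : κ ≤ sSup (d ∩ Set.Iio μ) := le_csSup ⟨b, hub⟩ hκ
  have hlt : sSup (d ∩ Set.Iio μ) < μ := (csSup_le ⟨κ, hκ⟩ hub).trans_lt hbμ
  have hmem := hclosure μ hμN
  have hne : κ ≠ sSup (d ∩ Set.Iio μ) := fun h => hκN (h ▸ hmem)
  exact (hleast _ hmem (hle.lt_of_ne hne)).not_gt hlt
end
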